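/- arXiv:1703.09539 — 2 statements merged into one kernel-verified Lean document; each statement's English description precedes it below -/
import Mathlib

section
/- Let F be a laminar family of intervals and let A ⊆ F be an antichain under strict containment (no member of A strictly contains another member of A). Then every member x of F has at most one member of A strictly containing it. Consequently, for every finite set D ⊆ F, the set J = {(a, d) ∈ A × D : a strictly contains d} has cardinality at most the cardinality of D, and the projection (a, d) ↦ d from J to D is injective. -/
/-- The interval `a = (l, r)` strictly contains the interval `b = (l', r')`:
`l < l'` and `r' < r`. -/
def Contains (a b : ℕ × ℕ) : Prop :=
  a.1 < b.1 ∧ b.2 < a.2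

instance : ∀ a b : ℕ × ℕ, Decidable (Contains a b) := fun a b =>
  inferInstanceAs (Decidable (a.1 < b.1 ∧ b.2 < a.2))

/-- A laminar family of intervals: a finite set of pairs `(l, r)` of natural
numbers with `l < r`, whose endpoint values are pairwise distinct, and such
that any two distinct members are either disjoint or one strictly contains
the other. -/
def LaminarFamily (F : Finset (ℕ × ℕ)) : Prop :=
  (∀ x ∈ F, x.1 < x.2) ∧
  (∀ x ∈ F, ∀ y ∈ F, x.1 = y.1 → x = y) ∧
  (∀ x ∈ F, ∀ y ∈ F, x.2 = y.2 → x = y) ∧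
  (∀ x ∈ F, ∀ y ∈ F, x.1 ≠ y.2) ∧
  (∀ x ∈ F, ∀ y ∈ F, x ≠ y →
    (x.2 < y.1 ∨ y.2 < x.1 ∨ Contains x y ∨ Contains y x))

/-- If `A` is an antichain (under strict containment) in a laminar family `F`,
then every member of `F` has at most one member of `A` strictly containing it;
consequently, for every `D ⊆ F` the join set
`J = {(a, d) ∈ A × D : a strictly contains d}` has cardinality at most `|D|`
and the projection `(a, d) ↦ d` is injective on `J`. -/
theorem laminar_antichain_at_most_one_container
    (F : Finset (ℕ × ℕ)) (hF : LaminarFamily F)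
    (A : Finset (ℕ × ℕ)) (hA : A ⊆ F)
    (hanti : ∀ a ∈ A, ∀ b ∈ A, ¬ Contains a b) :
    (∀ x ∈ F, ∀ a ∈ A, ∀ b ∈ A, Contains a x → Contains b x → a = b) ∧
    (∀ D : Finset (ℕ × ℕ), D ⊆ F →
      ((A ×ˢ D).filter (fun p => Contains p.1 p.2)).card ≤ D.card ∧
      Set.InjOn (fun p : (ℕ × ℕ) × (ℕ × ℕ) => p.2)
        ↑((A ×ˢ D).filter (fun p => Contains p.1 p.2))) := by
  have key : ∀ x ∈ F, ∀ a ∈ A, ∀ b ∈ A, Contains a x → Contains b x → a = b := by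
    intro x hx a ha b hb hax hbx
    by_contra hne
    have hlt := hF.1 x hx
    rcases hF.2.2.2.2 a (hA ha) b (hA hb) hne with h | h | h | h
    · unfold Contains at hax hbx
      omega
    · unfold Contains at hax hbx
      omega
    · exact hanti a ha b hb h
    · exact hanti b hb a ha h
  refine ⟨key, fun D hD => ?_⟩
  have hinj : Set.InjOn (fun p : (ℕ × ℕ) × (ℕ × ℕ) => p.2)
      ↑((A ×ˢ D).filter (fun p => Contains p.1 p.2)) := by
    rintro ⟨a, d⟩ hp ⟨b, e⟩ hq hde
    simp only [Finset.coe_filter, Finset.mem_product, Set.mem_setOf_eq] at hp hq hde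
    subst hde
    rw [key d (hD hp.1.2) a hp.1.1 b hq.1.1 hp.2 hq.2]
  refine ⟨Finset.card_le_card_of_injOn _ ?_ hinj, hinj⟩
  intro p hp
  simp only [Finset.coe_filter, Finset.mem_product, Set.mem_setOf_eq] at hp
  exact hp.1.2
end

section
/- Let (α, ≤) be a finite tree order (a finite partial order with a greatest element in which every set {u : v ≤ u} is a chain). Let S ⊆ α be a nonempty set closed under lowest common ancestors: for all s, t ∈ S, the least upper bound of s and t exists and lies in S. Define the query core C = {x ∈ α : ∃ s ∈ S, ∃ t ∈ S, s ≤ x and x ≤ t}. Then every element x ∈ C with x ∉ S has exactly one core child, i.e., there exists exactly one y ∈ C with y < x such that there is no z ∈ C with y < z < x. -/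
/-- The query core of a set `S` of (output) query nodes in a tree order:
the set of nodes lying on a path between two members of `S`. -/
def queryCore {α : Type} [PartialOrder α] (S : Set α) : Set α :=
  {x : α | ∃ s ∈ S, ∃ t ∈ S, s ≤ x ∧ x ≤ t}

/-- In a finite tree order, if `S` is a nonempty set closed under lowest
common ancestors (least upper bounds), then every element of the query core
of `S` that is not in `S` has exactly one core child: exactly one `y` in the
core with `y < x` such that no core element lies strictly between `y` and
`x`. -/
theorem queryCore_nonoutput_unique_core_child
    (α : Type) [Fintype α] [PartialOrder α]
    (root : α) (hroot : ∀ v : α, v ≤ root)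
    (hchain : ∀ v : α, IsChain (· ≤ ·) {u : α | v ≤ u})
    (S : Set α) (hS : S.Nonempty)
    (hlca : ∀ s ∈ S, ∀ t ∈ S, ∃ z ∈ S, IsLUB {s, t} z) :
    ∀ x ∈ queryCore S, x ∉ S →
      ∃! y : α, y ∈ queryCore S ∧ y < x ∧
        ¬ ∃ z ∈ queryCore S, y < z ∧ z < x := by
  rintro x ⟨s, hs, t, ht, hsx, hxt⟩ hx
  have hlt : ∀ a ∈ S, a ≤ x → a < x := fun a ha hax =>
    lt_of_le_of_ne hax (fun h => hx (h ▸ ha))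
  have hSC : ∀ a ∈ S, a ∈ queryCore S := fun a ha => ⟨a, ha, a, ha, le_rfl, le_rfl⟩
  have hcomp : ∀ v a b : α, v ≤ a → v ≤ b → a ≤ b ∨ b ≤ a := fun v a b ha hb =>
    (hchain v).total ha hb
  obtain ⟨m, hm⟩ := (Set.toFinite {y : α | y ∈ queryCore S ∧ y < x}).exists_maximal
    ⟨s, hSC s hs, hlt s hs hsx⟩
  have key : ∀ y y' : α, (y ∈ queryCore S ∧ y < x ∧ ¬ ∃ z ∈ queryCore S, y < z ∧ z < x) →
      (y' ∈ queryCore S ∧ y' < x ∧ ¬ ∃ z ∈ queryCore S, y' < z ∧ z < x) → y = y' := by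
    rintro y y' ⟨hyC, hyx, hy⟩ ⟨hyC', hyx', hy'⟩
    obtain ⟨a, ha, -, -, hay, -⟩ := id hyC
    obtain ⟨b, hb, -, -, hby, -⟩ := id hyC'
    obtain ⟨z, hz, hlub⟩ := hlca a ha b hb
    have haz : a ≤ z := hlub.1 (by simp)
    have hbz : b ≤ z := hlub.1 (by simp)
    have hzx : z < x := hlt z hz (hlub.2 (by
      rintro w (rfl | rfl)
      · exact hay.trans hyx.le
      · exact hby.trans hyx'.le))
    have hzy : z ≤ y := by
      rcases hcomp a z y haz hay with h | h
      · exact h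
      · by_contra hn
        exact hy ⟨z, hSC z hz, lt_of_le_not_ge h hn, hzx⟩
    rcases hcomp b y y' (hbz.trans hzy) hby with h | h
    · by_contra hn
      exact hy ⟨y', hyC', lt_of_le_of_ne h hn, hyx'⟩
    · by_contra hn
      exact hy' ⟨y, hyC, lt_of_le_of_ne h (Ne.symm hn), hyx⟩
  have hmm : m ∈ queryCore S ∧ m < x ∧ ¬ ∃ z ∈ queryCore S, m < z ∧ z < x :=
    ⟨hm.prop.1, hm.prop.2, fun ⟨z, hz, hmz, hzx⟩ => hm.not_gt ⟨hz, hzx⟩ hmz⟩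
  exact ⟨m, hmm, fun y hy => key y m hy hmm⟩
end
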